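/- arXiv:1210.8400 — 3 statements merged into one kernel-verified Lean document; each statement's English description precedes it below -/
import Mathlib

section
/- (Optimal cost allocation, KKT form.) Let N ≥ 1, let β_n > 0 and α_n > 0 for n = 1,...,N, and let C > 0. Consider minimizing F(b) = Σ_{n=1}^N β_n 2^{−2 b_n/α_n} over allocations b ∈ ℝ^N with b_n ≥ 0 and Σ_{n=1}^N b_n = C. Then there exists β̃ > 0 such that the allocation b_n* = max(0, (α_n/2) log_2((β_n/α_n)/β̃)) satisfies Σ_{n=1}^N b_n* = C, and every such allocation b* is a global minimizer of F over the feasible set. -/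
open scoped BigOperators

lemma key_aux (β α t b : ℝ) (hβ : 0 < β) (hα : 0 < α) (ht : 0 < t) (hb : 0 ≤ b) :
    β * (2 : ℝ) ^ (-2 * max 0 ((α / 2) * Real.logb 2 (β / α / t)) / α) ≤
      β * (2 : ℝ) ^ (-2 * b / α) +
        2 * Real.log 2 * t * (b - max 0 ((α / 2) * Real.logb 2 (β / α / t))) := by
  have hl : 0 < Real.log 2 := Real.log_pos (by norm_num)
  have hx : 0 < β / α / t := by positivity
  set m := max 0 ((α / 2) * Real.logb 2 (β / α / t)) with hm
  have h1 : (2 : ℝ) ^ (-2 * b / α) =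
      (2 : ℝ) ^ (-2 * m / α) * Real.exp (-(2 * Real.log 2 / α) * (b - m)) := by
    rw [Real.rpow_def_of_pos (by norm_num), Real.rpow_def_of_pos (by norm_num), ← Real.exp_add]
    congr 1
    field_simp
    ring
  have h2 := Real.add_one_le_exp (-(2 * Real.log 2 / α) * (b - m))
  have hp : 0 < (2 : ℝ) ^ (-2 * m / α) := by positivity
  have h3 : β * (2 : ℝ) ^ (-2 * m / α) * (b - m) ≤ α * t * (b - m) := by
    rcases le_total (Real.logb 2 (β / α / t)) 0 with h | h
    · have hm0 : m = 0 := by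
        rw [hm]; exact max_eq_left (mul_nonpos_of_nonneg_of_nonpos (by positivity) h)
      have h4 : β / α / t ≤ 1 := by
        rwa [Real.logb_nonpos_iff (by norm_num) hx] at h
      rw [div_div, div_le_one (by positivity)] at h4
      rw [hm0]
      simp
      exact mul_le_mul_of_nonneg_right h4 hb
    · have hm0 : m = (α / 2) * Real.logb 2 (β / α / t) := by
        rw [hm]; exact max_eq_right (by positivity)
      have h5 : -2 * m / α = - Real.logb 2 (β / α / t) := by
        rw [hm0]; field_simp
      rw [h5, Real.rpow_neg (by norm_num), Real.rpow_logb (by norm_num) (by norm_num) hx]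
      apply le_of_eq
      field_simp
  have h6 : β * (2 : ℝ) ^ (-2 * m / α) * (-(2 * Real.log 2 / α) * (b - m) + 1) ≤
      β * (2 : ℝ) ^ (-2 * b / α) := by
    rw [h1, ← mul_assoc]
    exact mul_le_mul_of_nonneg_left h2 (by positivity)
  have h7 := mul_le_mul_of_nonneg_left h3 (show 0 ≤ 2 * Real.log 2 / α by positivity)
  have h8 : 2 * Real.log 2 / α * (α * t * (b - m)) = 2 * Real.log 2 * t * (b - m) := by
    field_simp
  rw [h8] at h7
  linarith

theorem stmt_7 (N : ℕ) (hN : 1 ≤ N) (β α : Fin N → ℝ)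
    (hβ : ∀ n, 0 < β n) (hα : ∀ n, 0 < α n) (C : ℝ) (hC : 0 < C) :
    ∃ btil : ℝ, 0 < btil ∧
      (∑ n, max 0 ((α n / 2) * Real.logb 2 (β n / α n / btil))) = C ∧
      ∀ btil' : ℝ, 0 < btil' →
        (∑ n, max 0 ((α n / 2) * Real.logb 2 (β n / α n / btil'))) = C →
        ∀ b : Fin N → ℝ, (∀ n, 0 ≤ b n) → (∑ n, b n) = C →
          (∑ n, β n * (2 : ℝ) ^ (-2 * max 0 ((α n / 2) * Real.logb 2 (β n / α n / btil')) / α n))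
            ≤ ∑ n, β n * (2 : ℝ) ^ (-2 * b n / α n) := by
  have hex : ∃ t : ℝ, (∑ n, max 0 ((α n / 2) * (Real.logb 2 (β n / α n) - t))) = C := by
    have hc : Continuous (fun t : ℝ =>
        ∑ n, max 0 ((α n / 2) * (Real.logb 2 (β n / α n) - t))) := by fun_prop
    let i : Fin N := ⟨0, hN⟩
    apply mem_range_of_exists_le_of_exists_ge hc
    · refine ⟨∑ n, |Real.logb 2 (β n / α n)|, ?_⟩
      refine le_trans (le_of_eq (Finset.sum_eq_zero fun n _ => ?_)) hC.le
      have h1 := Finset.single_le_sum (f := fun n => |Real.logb 2 (β n / α n)|)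
        (fun n _ => abs_nonneg _) (Finset.mem_univ n)
      have h2 := le_abs_self (Real.logb 2 (β n / α n))
      have h3 := hα n
      refine max_eq_left (mul_nonpos_of_nonneg_of_nonpos (by positivity) ?_)
      linarith
    · refine ⟨Real.logb 2 (β i / α i) - 2 * C / α i, ?_⟩
      refine le_trans ?_ (Finset.single_le_sum (fun n _ => le_max_left _ _) (Finset.mem_univ i))
      refine le_trans (le_of_eq ?_) (le_max_right _ _)
      have := (hα i).ne'
      field_simp
      ring
  obtain ⟨t, ht⟩ := hex
  refine ⟨2 ^ t, by positivity, ?_, ?_⟩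
  · rw [← ht]
    refine Finset.sum_congr rfl fun n _ => ?_
    have h1 := hα n
    have h2 := hβ n
    rw [Real.logb_div (x := β n / α n) (by positivity) (by positivity),
      Real.logb_rpow (by norm_num) (by norm_num)]
  · intro s hs hsum b hb hbs
    have h := Finset.sum_le_sum fun n (_ : n ∈ Finset.univ) =>
      key_aux (β n) (α n) s (b n) (hβ n) (hα n) hs (hb n)
    rw [Finset.sum_add_distrib, ← Finset.mul_sum, Finset.sum_sub_distrib, hsum, hbs] at h
    simpa using h
end

section
/- (Probabilistic cost allocation, closed form.) For n = 1,...,N let 𝓜_n be a finite set with probability mass function f_n, and let α_n(m) > 0 and β_n(m) > 0 for each m ∈ 𝓜_n; let C > 0 and set α̃ = Σ_{n=1}^N Σ_{m ∈ 𝓜_n} f_n(m) α_n(m). Define b_n*(m) = (α_n(m)/α̃) C + (α_n(m)/2) log_2( (β_n(m)/α_n(m)) / Π_{j=1}^N Π_{l ∈ 𝓜_j} (β_j(l)/α_j(l))^{f_j(l) α_j(l)/α̃} ). Then Σ_n Σ_m f_n(m) b_n*(m) = C, and if b_n*(m) > 0 for all n and m, then b* is the global minimizer of Σ_{n=1}^N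 Σ_{m ∈ 𝓜_n} f_n(m) β_n(m) 2^{−2 b_n(m)/α_n(m)} over allocations {b_n(m) ≥ 0} satisfying the average-cost constraint Σ_n Σ_m f_n(m) b_n(m) = C. -/
open scoped BigOperators

theorem stmt_9 (N : ℕ) (hN : 1 ≤ N) (M : Fin N → Type*) [∀ n, Fintype (M n)]
    (f : ∀ n, M n → ℝ) (hf0 : ∀ n m, 0 ≤ f n m) (hf1 : ∀ n, (∑ m, f n m) = 1)
    (α β : ∀ n, M n → ℝ) (hα : ∀ n m, 0 < α n m) (hβ : ∀ n m, 0 < β n m)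
    (C : ℝ) (hC : 0 < C) :
    let αt : ℝ := ∑ n, ∑ m, f n m * α n m
    let G : ℝ := ∏ j, ∏ l, (β j l / α j l) ^ (f j l * α j l / αt)
    let bs : ∀ n, M n → ℝ :=
      fun n m => (α n m / αt) * C + (α n m / 2) * Real.logb 2 (β n m / α n m / G)
    (∑ n, ∑ m, f n m * bs n m) = C ∧
      ((∀ n m, 0 < bs n m) →
        ∀ b : ∀ n, M n → ℝ, (∀ n m, 0 ≤ b n m) → (∑ n, ∑ m, f n m * b n m) = C →
          (∑ n, ∑ m, f n m * (β n m * (2 : ℝ) ^ (-2 * bs n m / α n m)))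
            ≤ ∑ n, ∑ m, f n m * (β n m * (2 : ℝ) ^ (-2 * b n m / α n m))) := by
  intro αt G bs
  have hαt : 0 < αt := by
    apply Finset.sum_pos
    · intro n _
      have hnn : ∀ m ∈ Finset.univ, 0 ≤ f n m * α n m :=
        fun m _ => mul_nonneg (hf0 n m) (hα n m).le
      rcases (Finset.sum_nonneg hnn).lt_or_eq with h | h
      · exact h
      · exfalso
        have h0 := (Finset.sum_eq_zero_iff_of_nonneg hnn).1 h.symm
        have h1 : (∑ m, f n m) = 0 := by
          apply Finset.sum_eq_zero
          intro m hm
          rcases mul_eq_zero.1 (h0 m hm) with h2 | h2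
          · exact h2
          · exact absurd h2 (hα n m).ne'
        rw [hf1 n] at h1
        exact one_ne_zero h1
    · exact ⟨⟨0, hN⟩, Finset.mem_univ _⟩
  have hr : ∀ n m, 0 < β n m / α n m := fun n m => div_pos (hβ n m) (hα n m)
  have hG : 0 < G :=
    Finset.prod_pos fun n _ => Finset.prod_pos fun m _ => Real.rpow_pos_of_pos (hr n m) _
  have hlog : Real.logb 2 G
      = (∑ n, ∑ m, f n m * α n m * Real.logb 2 (β n m / α n m)) / αt := by
    have h1 : Real.logb 2 G
        = ∑ n, ∑ m, f n m * α n m / αt * Real.logb 2 (β n m / α n m) := by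
      rw [Real.logb_prod _ _ (fun n _ =>
        (Finset.prod_pos fun m _ => Real.rpow_pos_of_pos (hr n m) _).ne')]
      refine Finset.sum_congr rfl fun n _ => ?_
      rw [Real.logb_prod _ _ (fun m _ => (Real.rpow_pos_of_pos (hr n m) _).ne')]
      exact Finset.sum_congr rfl fun m _ => Real.logb_rpow_eq_mul_logb_of_pos (hr n m)
    rw [h1, Finset.sum_div]
    refine Finset.sum_congr rfl fun n _ => ?_
    rw [Finset.sum_div]
    exact Finset.sum_congr rfl fun m _ => by ring
  have hsum : (∑ n, ∑ m, f n m * bs n m) = C := by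
    have h1 : ∀ n m, f n m * bs n m = f n m * α n m * (C / αt - Real.logb 2 G / 2)
        + f n m * α n m * Real.logb 2 (β n m / α n m) * (1 / 2) := by
      intro n m
      simp only [bs]
      rw [Real.logb_div (hr n m).ne' hG.ne']
      ring
    simp only [h1, Finset.sum_add_distrib, ← Finset.sum_mul]
    change αt * _ + _ = C
    rw [hlog]
    field_simp
    ring
  refine ⟨hsum, fun _ b _ hb => ?_⟩
  set K : ℝ := G * (2 : ℝ) ^ (-2 * C / αt) with hK
  have hK0 : 0 < K := mul_pos hG (Real.rpow_pos_of_pos two_pos _)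
  have hopt : ∀ n m, β n m * (2 : ℝ) ^ (-2 * bs n m / α n m) = α n m * K := by
    intro n m
    have hα' := (hα n m).ne'
    have hβ' := (hβ n m).ne'
    have e : -2 * bs n m / α n m
        = -2 * C / αt + -Real.logb 2 (β n m / α n m / G) := by
      simp only [bs]
      field_simp
      ring
    rw [e, Real.rpow_add two_pos, Real.rpow_neg two_pos.le,
      Real.rpow_logb two_pos (by norm_num) (div_pos (hr n m) hG), hK]
    field_simp
  have hpt : ∀ n m, f n m * (β n m * (2 : ℝ) ^ (-2 * bs n m / α n m))
      + (f n m * bs n m - f n m * b n m) * (2 * Real.log 2 * K)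
      ≤ f n m * (β n m * (2 : ℝ) ^ (-2 * b n m / α n m)) := by
    intro n m
    have hα' := (hα n m).ne'
    have e : -2 * b n m / α n m
        = -2 * bs n m / α n m + 2 * (bs n m - b n m) / α n m := by ring
    have h2 : Real.log 2 * (2 * (bs n m - b n m) / α n m) + 1
        ≤ (2 : ℝ) ^ (2 * (bs n m - b n m) / α n m) := by
      rw [Real.rpow_def_of_pos two_pos]
      exact Real.add_one_le_exp _
    rw [e, Real.rpow_add two_pos, ← mul_assoc (β n m), hopt]
    have h3 := mul_le_mul_of_nonneg_left h2
      (mul_nonneg (hf0 n m) (mul_pos (hα n m) hK0).le)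
    calc _ = f n m * (α n m * K) * (Real.log 2 * (2 * (bs n m - b n m) / α n m) + 1) := by
            field_simp
            ring
      _ ≤ _ := h3
      _ = _ := by ring
  have htot := Finset.sum_le_sum fun n (_ : n ∈ Finset.univ) =>
    Finset.sum_le_sum fun m (_ : m ∈ Finset.univ) => hpt n m
  simp only [Finset.sum_add_distrib, ← Finset.sum_mul, Finset.sum_sub_distrib] at htot
  rw [hsum, hb, sub_self, zero_mul, add_zero] at htot
  exact htot
end

section
/- (Entropy-constrained distortion–cost trade-off for the maximum computation.) Let N ≥ 1 and C > 0, let X ~ Uniform[0,1], and let γ(x) = x^{(N−1)/2}. Then the differential entropy h(X) = 0 and E[log_2 γ(X)] = −(N−1)/(2 ln 2), so 2^{2h(X) + 2E[log_2 γ(X)]} = e^{−(N−1)}; consequently, the minimum of Σ_{n=1}^N (1/12) e^{−(N−1)} 2^{−2R_n} over rates R_n ≥ 0 with Σ_{n=1}^N R_n = C is attained at R_n = C/N for all n and equals (N/12) e^{−(N−1)} 2^{−2C/N}. -/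
open scoped BigOperators

theorem stmt_11 (N : ℕ) (hN : 1 ≤ N) (C : ℝ) (hC : 0 < C) :
    -- h(X) = 0 for X ~ Uniform[0,1] (density is the indicator of [0,1])
    (-(∫ x : ℝ, (Set.Icc (0:ℝ) 1).indicator (fun _ => (1:ℝ)) x *
          Real.logb 2 ((Set.Icc (0:ℝ) 1).indicator (fun _ => (1:ℝ)) x)) = 0) ∧
    -- E[log₂ γ(X)] = -(N-1)/(2 ln 2) for γ(x) = x^{(N-1)/2}
    ((∫ x in Set.Icc (0:ℝ) 1, Real.logb 2 (x ^ (((N : ℝ) - 1) / 2)))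
        = -((N : ℝ) - 1) / (2 * Real.log 2)) ∧
    -- 2^{2h(X) + 2E[log₂ γ(X)]} = e^{-(N-1)}
    ((2 : ℝ) ^ (2 * (0:ℝ) + 2 * (-((N : ℝ) - 1) / (2 * Real.log 2)))
        = Real.exp (-((N : ℝ) - 1))) ∧
    -- the minimum over nonnegative rates summing to C is attained at Rₙ = C/N …
    (∀ R : Fin N → ℝ, (∀ n, 0 ≤ R n) → (∑ n, R n) = C →
        (N : ℝ) / 12 * Real.exp (-((N : ℝ) - 1)) * (2 : ℝ) ^ (-2 * C / N)
          ≤ ∑ _n : Fin N, 1 / 12 * Real.exp (-((N : ℝ) - 1)) * (2 : ℝ) ^ (-2 * R _n)) ∧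
    -- … and equals (N/12) e^{-(N-1)} 2^{-2C/N}
    ((∑ _n : Fin N, 1 / 12 * Real.exp (-((N : ℝ) - 1)) * (2 : ℝ) ^ (-2 * (C / N)))
      = (N : ℝ) / 12 * Real.exp (-((N : ℝ) - 1)) * (2 : ℝ) ^ (-2 * C / N)) := by
  have hNpos : (0:ℝ) < N := by exact_mod_cast hN
  have hN0 : (N:ℝ) ≠ 0 := hNpos.ne'
  have hl : Real.log 2 ≠ 0 := (Real.log_pos (by norm_num)).ne'
  refine ⟨?_, ?_, ?_, ?_, ?_⟩
  · have h0 : ∀ x : ℝ, (Set.Icc (0:ℝ) 1).indicator (fun _ => (1:ℝ)) x *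
          Real.logb 2 ((Set.Icc (0:ℝ) 1).indicator (fun _ => (1:ℝ)) x) = 0 := by
      intro x
      by_cases hx : x ∈ Set.Icc (0:ℝ) 1
      · simp only [Set.indicator_of_mem hx, Real.logb_one, mul_zero]
      · simp only [Set.indicator_of_notMem hx, zero_mul]
    simp only [h0, MeasureTheory.integral_zero, neg_zero]
  · rw [MeasureTheory.integral_Icc_eq_integral_Ioc]
    have h1 : ∫ x in Set.Ioc (0:ℝ) 1, Real.logb 2 (x ^ (((N : ℝ) - 1) / 2))
        = ∫ x in Set.Ioc (0:ℝ) 1, (((N : ℝ) - 1) / 2 / Real.log 2) * Real.log x := by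
      apply MeasureTheory.setIntegral_congr_fun measurableSet_Ioc
      intro x hx
      simp only [Real.logb, Real.log_rpow hx.1]
      ring
    rw [h1, MeasureTheory.integral_const_mul,
      ← intervalIntegral.integral_of_le zero_le_one, integral_log]
    simp only [Real.log_one, Real.log_zero]
    field_simp
    ring
  · rw [Real.rpow_def_of_pos (by norm_num)]
    congr 1
    field_simp
    ring
  · intro R _ hR
    have key : ∀ n, (2:ℝ) ^ (-2 * C / N) * (1 + Real.log 2 * (-2) * (R n - C / N))
        ≤ (2:ℝ) ^ (-2 * R n) := by
      intro n
      have e : (2:ℝ) ^ (-2 * R n)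
          = (2:ℝ) ^ (-2 * C / N) * Real.exp (Real.log 2 * (-2) * (R n - C / N)) := by
        rw [Real.rpow_def_of_pos (by norm_num), Real.rpow_def_of_pos (by norm_num),
          ← Real.exp_add]
        congr 1
        ring
      rw [e]
      apply mul_le_mul_of_nonneg_left _ (by positivity)
      linarith [Real.add_one_le_exp (Real.log 2 * (-2) * (R n - C / N))]
    have hs : ∑ n, (2:ℝ) ^ (-2 * C / N) * (1 + Real.log 2 * (-2) * (R n - C / N))
        = N * (2:ℝ) ^ (-2 * C / N) := by
      rw [← Finset.mul_sum, Finset.sum_add_distrib, ← Finset.mul_sum, Finset.sum_sub_distrib, hR]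
      simp only [Finset.sum_const, Finset.card_univ, Fintype.card_fin, nsmul_eq_mul]
      rw [mul_div_cancel₀ _ hN0]
      ring
    rw [← Finset.mul_sum]
    have hk := Finset.sum_le_sum (fun n (_ : n ∈ Finset.univ) => key n)
    rw [hs] at hk
    have := mul_le_mul_of_nonneg_left hk
      (by positivity : 0 ≤ 1 / 12 * Real.exp (-((N : ℝ) - 1)))
    refine le_trans (le_of_eq ?_) this
    ring
  · simp only [Finset.sum_const, Finset.card_univ, Fintype.card_fin, nsmul_eq_mul]
    rw [← mul_div_assoc]
    ring
end
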